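/- arXiv:1612.06815 — 2 statements merged into one kernel-verified Lean document; each statement's English description precedes it below -/
import Mathlib

section
/- Let f : ℝ → ℝ be a continuously differentiable function whose support is a compact subset of the open interval (−π/2, π/2). Then ∫_{−π/2}^{π/2} f(x)² dx ≤ ∫_{−π/2}^{π/2} (f′(x))² dx. -/
open Real MeasureTheory intervalIntegral

/-- **Wirtinger inequality** on the interval `(-π/2, π/2)`:
if `f : ℝ → ℝ` is continuously differentiable and its support is a compact
subset of the open interval `(-π/2, π/2)`, then
`∫ f² ≤ ∫ (f')²` over that interval. -/
theorem wirtinger_inequality (f : ℝ → ℝ)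
    (hf : ContDiff ℝ 1 f)
    (hsupp_compact : HasCompactSupport f)
    (hsupp : tsupport f ⊆ Set.Ioo (-(π / 2)) (π / 2)) :
    ∫ x in (-(π / 2))..(π / 2), (f x) ^ 2
      ≤ ∫ x in (-(π / 2))..(π / 2), (deriv f x) ^ 2 := by
  have hcos : ∀ x ∈ tsupport f, cos x ≠ 0 := fun x hx =>
    (cos_pos_of_mem_Ioo (hsupp hx)).ne'
  have hdiff : Differentiable ℝ f := hf.differentiable (by norm_num)
  have hfc : Continuous f := hf.continuous
  have hdc : Continuous (deriv f) := hf.continuous_deriv (by norm_num)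
  have hhc : Continuous (fun x => f x * tan x) := by
    rw [continuous_iff_continuousAt]
    intro x
    by_cases hx : x ∈ tsupport f
    · exact hfc.continuousAt.mul (continuousAt_tan.2 (hcos x hx))
    · have h0 := notMem_tsupport_iff_eventuallyEq.1 hx
      have h1 : (fun x => f x * tan x) =ᶠ[nhds x] fun _ => (0 : ℝ) := by
        filter_upwards [h0] with y hy
        simp [hy]
      exact (continuousAt_const (y := (0 : ℝ))).congr h1.symm
  have hG : ∀ x, HasDerivAt (fun x => f x ^ 2 * tan x)
      (2 * deriv f x * (f x * tan x) + f x ^ 2 + (f x * tan x) ^ 2) x := by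
    intro x
    by_cases hx : x ∈ tsupport f
    · have hc := hcos x hx
      have h := ((hdiff x).hasDerivAt.pow 2).mul (hasDerivAt_tan hc)
      refine h.congr_deriv ?_
      simp only [Pi.pow_apply, tan_eq_sin_div_cos]
      have hsc := sin_sq_add_cos_sq x
      field_simp
      push_cast
      linear_combination (-f x ^ 2) * hsc
    · have h0 := notMem_tsupport_iff_eventuallyEq.1 hx
      have h1 : (fun x => f x ^ 2 * tan x) =ᶠ[nhds x] fun _ => (0 : ℝ) := by
        filter_upwards [h0] with y hy
        simp [hy]
      have hfx : f x = 0 := h0.self_of_nhds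
      refine ((hasDerivAt_const x (0 : ℝ)).congr_of_eventuallyEq h1).congr_deriv ?_
      simp [hfx]
  have hcont : Continuous (fun x =>
      2 * deriv f x * (f x * tan x) + f x ^ 2 + (f x * tan x) ^ 2) :=
    (((continuous_const.mul hdc).mul hhc).add (hfc.pow 2)).add (hhc.pow 2)
  have hint := integral_eq_sub_of_hasDerivAt (a := -(π / 2)) (b := π / 2)
    (fun x _ => hG x) (hcont.intervalIntegrable _ _)
  simp only [tan_neg, tan_pi_div_two, neg_zero, mul_zero, sub_zero] at hint
  have hle : (-(π / 2)) ≤ π / 2 := by linarith [pi_pos]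
  have key : ∫ x in (-(π / 2))..(π / 2), (f x) ^ 2 ≤ ∫ x in (-(π / 2))..(π / 2),
      ((deriv f x) ^ 2 + (2 * deriv f x * (f x * tan x) + f x ^ 2 + (f x * tan x) ^ 2)) := by
    refine integral_mono_on hle ((hfc.pow 2).intervalIntegrable _ _)
      (((hdc.pow 2).add hcont).intervalIntegrable _ _) fun x _ => ?_
    nlinarith [sq_nonneg (deriv f x + f x * tan x)]
  have hdc2 : Continuous (fun x => deriv f x ^ 2) := hdc.pow 2
  rw [integral_add (hdc2.intervalIntegrable _ _) (hcont.intervalIntegrable _ _), hint,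
    add_zero] at key
  exact key
end

section
/- Let V₃, V₄ : ℝ × ℝ → ℝ be smooth functions whose supports are compact subsets of the open strip (−π/2, π/2) × ℝ. Then ∫_ℝ ∫_{−π/2}^{π/2} V₃(x,y)² dx dy ≤ ∫_ℝ ∫_{−π/2}^{π/2} [ (∂V₃/∂x)² + (∂V₄/∂x)² + (1/cos²x)·( (∂V₃/∂y)² + (∂V₄/∂y)² ) ] dx dy. -/
open Real MeasureTheory intervalIntegral

lemma gr_tan_mul_cont (f : ℝ → ℝ) (hf : Continuous f)
    (hs : tsupport f ⊆ Set.Ioo (-(π / 2)) (π / 2)) : Continuous (fun x => Real.tan x * f x) := by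
  have hs' : tsupport (fun x => Real.tan x * f x) ⊆ Set.Ioo (-(π / 2)) (π / 2) :=
    (tsupport_mul_subset_right (f := Real.tan) (g := f)).trans hs
  refine ContinuousOn.continuous_of_tsupport_subset ?_ isOpen_Ioo hs'
  exact Real.continuousOn_tan_Ioo.mul hf.continuousOn

lemma gr_oned (f : ℝ → ℝ) (hf : ContDiff ℝ 1 f)
    (hs : tsupport f ⊆ Set.Ioo (-(π / 2)) (π / 2)) :
    ∫ x in (-(π / 2))..(π / 2), (f x) ^ 2 ≤ ∫ x in (-(π / 2))..(π / 2), (deriv f x) ^ 2 := by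
  have hc := hf.continuous
  have hd : Continuous (deriv f) := hf.continuous_deriv le_rfl
  have hh := gr_tan_mul_cont f hc hs
  have h0 : ∀ x, x ∉ Set.Ioo (-(π / 2)) (π / 2) → f x = 0 := fun x hx =>
    image_eq_zero_of_notMem_tsupport (fun h => hx (hs h))
  have hD : ∀ x, HasDerivAt (fun x => f x ^ 2 * Real.tan x)
      (2 * deriv f x * (Real.tan x * f x) + f x ^ 2 + (Real.tan x * f x) ^ 2) x := by
    intro x
    by_cases hx : x ∈ Set.Ioo (-(π / 2)) (π / 2)
    · have hcos : Real.cos x ≠ 0 := (Real.cos_pos_of_mem_Ioo hx).ne'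
      have h1 := ((hf.differentiable (by norm_num) x).hasDerivAt.pow 2).mul
        (Real.hasDerivAt_tan hcos)
      refine h1.congr_deriv ?_
      have : 1 / Real.cos x ^ 2 = 1 + Real.tan x ^ 2 := by
        rw [Real.tan_eq_sin_div_cos]
        field_simp
        linarith [Real.sin_sq_add_cos_sq x]
      rw [this]
      simp
      ring
    · have he : f =ᶠ[nhds x] 0 := notMem_tsupport_iff_eventuallyEq.1 (fun h => hx (hs h))
      have hw : (fun x => f x ^ 2 * Real.tan x) =ᶠ[nhds x] fun _ => 0 := by
        filter_upwards [he] with z hz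
        simp [hz]
      rw [h0 x hx]
      simpa using (hasDerivAt_const x (0 : ℝ)).congr_of_eventuallyEq hw
  have hDc : Continuous (fun x => 2 * deriv f x * (Real.tan x * f x) + f x ^ 2
      + (Real.tan x * f x) ^ 2) :=
    (((continuous_const.mul hd).mul hh).add (hc.pow 2)).add (hh.pow 2)
  have hint := intervalIntegral.integral_eq_sub_of_hasDerivAt
    (a := -(π / 2)) (b := π / 2) (fun x _ => hD x) (hDc.intervalIntegrable _ _)
  rw [h0 (π / 2) (by simp), h0 (-(π / 2)) (by simp)] at hint
  have hle : (-(π / 2)) ≤ π / 2 := by linarith [Real.pi_pos]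
  have hsq : 0 ≤ ∫ x in (-(π / 2))..(π / 2), (deriv f x + Real.tan x * f x) ^ 2 :=
    intervalIntegral.integral_nonneg hle (fun x _ => sq_nonneg _)
  have heq : (fun x => (deriv f x + Real.tan x * f x) ^ 2) = fun x =>
      ((deriv f x) ^ 2 - f x ^ 2) + (2 * deriv f x * (Real.tan x * f x) + f x ^ 2
      + (Real.tan x * f x) ^ 2) := by
    funext x; ring
  have hd2 : Continuous (fun x => deriv f x ^ 2) := hd.pow 2
  have hc2 : Continuous (fun x => f x ^ 2) := hc.pow 2
  have hdc2 : Continuous (fun x => deriv f x ^ 2 - f x ^ 2) := hd2.sub hc2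
  rw [heq, intervalIntegral.integral_add
      (hdc2.intervalIntegrable _ _) (hDc.intervalIntegrable _ _),
    hint, intervalIntegral.integral_sub (hd2.intervalIntegrable _ _)
      (hc2.intervalIntegrable _ _)] at hsq
  linarith

lemma gr_derivx (V : ℝ × ℝ → ℝ) (hV : ContDiff ℝ (⊤ : ℕ∞) V) (x y : ℝ) :
    deriv (fun x' => V (x', y)) x = fderiv ℝ V (x, y) (1, 0) := by
  have h : HasFDerivAt V (fderiv ℝ V (x, y)) (x, y) :=
    (hV.differentiable (by simp) (x, y)).hasFDerivAt
  exact (h.comp_hasDerivAt x ((hasDerivAt_id x).prodMk (hasDerivAt_const x y))).deriv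

lemma gr_derivy (V : ℝ × ℝ → ℝ) (hV : ContDiff ℝ (⊤ : ℕ∞) V) (x y : ℝ) :
    deriv (fun y' => V (x, y')) y = fderiv ℝ V (x, y) (0, 1) := by
  have h : HasFDerivAt V (fderiv ℝ V (x, y)) (x, y) :=
    (hV.differentiable (by simp) (x, y)).hasFDerivAt
  exact (h.comp_hasDerivAt y ((hasDerivAt_const y x).prodMk (hasDerivAt_id y))).deriv

lemma gr_fderiv_cont (V : ℝ × ℝ → ℝ) (hV : ContDiff ℝ (⊤ : ℕ∞) V) (v : ℝ × ℝ) :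
    Continuous (fun p => fderiv ℝ V p v) :=
  (hV.continuous_fderiv (by simp)).clm_apply continuous_const

lemma gr_weight (V : ℝ × ℝ → ℝ) (hV : ContDiff ℝ (⊤ : ℕ∞) V)
    (hs : tsupport V ⊆ Set.Ioo (-(π / 2)) (π / 2) ×ˢ (Set.univ : Set ℝ)) :
    Continuous (fun p : ℝ × ℝ => (1 / Real.cos p.1 ^ 2) * (fderiv ℝ V p (0, 1)) ^ 2) := by
  have hs' : tsupport (fun p : ℝ × ℝ => (1 / Real.cos p.1 ^ 2) * (fderiv ℝ V p (0, 1)) ^ 2)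
      ⊆ Set.Ioo (-(π / 2)) (π / 2) ×ˢ (Set.univ : Set ℝ) := by
    refine Set.Subset.trans ?_ hs
    refine Set.Subset.trans ?_ (tsupport_fderiv_subset ℝ)
    refine closure_mono ?_
    intro p hp hq
    apply hp
    simp [hq]
  refine ContinuousOn.continuous_of_tsupport_subset ?_ (isOpen_Ioo.prod isOpen_univ) hs'
  refine ContinuousOn.mul ?_ ((gr_fderiv_cont V hV _).pow 2).continuousOn
  refine ContinuousOn.div continuousOn_const (by fun_prop) ?_
  rintro p ⟨hp, -⟩
  exact pow_ne_zero _ (Real.cos_pos_of_mem_Ioo hp).ne'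

lemma gr_cs (V : ℝ × ℝ → ℝ) (hc : HasCompactSupport V) :
    HasCompactSupport (fun p => fderiv ℝ V p) := hc.fderiv ℝ

/-- The coordinate form of the `L`-stability inequality for the Grim Reaper
cylinder `Γ × ℝ` in `ℂ²`: for smooth compactly supported normal variations
`V = V₃ e₃ + V₄ e₄` with support a compact subset of the open strip
`(-π/2, π/2) × ℝ`, we have
`∫∫ V₃² ≤ ∫∫ [(∂V₃/∂x)² + (∂V₄/∂x)² + (1/cos²x)((∂V₃/∂y)² + (∂V₄/∂y)²)]`. -/
theorem grim_reaper_cylinder_L_stability_inequality (V₃ V₄ : ℝ × ℝ → ℝ)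
    (hV₃ : ContDiff ℝ (⊤ : ℕ∞) V₃) (hV₄ : ContDiff ℝ (⊤ : ℕ∞) V₄)
    (hsupp_compact₃ : HasCompactSupport V₃) (hsupp_compact₄ : HasCompactSupport V₄)
    (hsupp₃ : tsupport V₃ ⊆ Set.Ioo (-(π / 2)) (π / 2) ×ˢ (Set.univ : Set ℝ))
    (hsupp₄ : tsupport V₄ ⊆ Set.Ioo (-(π / 2)) (π / 2) ×ˢ (Set.univ : Set ℝ)) :
    ∫ y : ℝ, ∫ x in (-(π / 2))..(π / 2), (V₃ (x, y)) ^ 2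
      ≤ ∫ y : ℝ, ∫ x in (-(π / 2))..(π / 2),
          ((deriv (fun x' => V₃ (x', y)) x) ^ 2
            + (deriv (fun x' => V₄ (x', y)) x) ^ 2
            + (1 / Real.cos x ^ 2) *
                ((deriv (fun y' => V₃ (x, y')) y) ^ 2
                  + (deriv (fun y' => V₄ (x, y')) y) ^ 2)) := by
  have hle : (-(π / 2)) ≤ π / 2 := by linarith [Real.pi_pos]
  simp only [gr_derivx V₃ hV₃, gr_derivx V₄ hV₄, gr_derivy V₃ hV₃, gr_derivy V₄ hV₄]
  have hFc : Continuous (fun p : ℝ × ℝ => (fderiv ℝ V₃ p (1, 0)) ^ 2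
      + (fderiv ℝ V₄ p (1, 0)) ^ 2 + (1 / Real.cos p.1 ^ 2) *
        ((fderiv ℝ V₃ p (0, 1)) ^ 2 + (fderiv ℝ V₄ p (0, 1)) ^ 2)) := by
    simp only [mul_add]
    exact (((gr_fderiv_cont V₃ hV₃ _).pow 2).add ((gr_fderiv_cont V₄ hV₄ _).pow 2)).add
      ((gr_weight V₃ hV₃ hsupp₃).add (gr_weight V₄ hV₄ hsupp₄))
  have hFs : HasCompactSupport (fun p : ℝ × ℝ => (fderiv ℝ V₃ p (1, 0)) ^ 2
      + (fderiv ℝ V₄ p (1, 0)) ^ 2 + (1 / Real.cos p.1 ^ 2) *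
        ((fderiv ℝ V₃ p (0, 1)) ^ 2 + (fderiv ℝ V₄ p (0, 1)) ^ 2)) := by
    refine HasCompactSupport.intro (IsCompact.union (gr_cs V₃ hsupp_compact₃)
      (gr_cs V₄ hsupp_compact₄)) ?_
    intro p hp
    rw [Set.mem_union, not_or] at hp
    have h3 : fderiv ℝ V₃ p = 0 := image_eq_zero_of_notMem_tsupport hp.1
    have h4 : fderiv ℝ V₄ p = 0 := image_eq_zero_of_notMem_tsupport hp.2
    simp [h3, h4]
  refine integral_mono_of_nonneg ?_ ?_ ?_
  · exact Filter.Eventually.of_forall fun y =>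
      intervalIntegral.integral_nonneg hle (fun x _ => sq_nonneg _)
  · simp only [intervalIntegral.integral_of_le hle]
    have hI := hFc.integrable_of_hasCompactSupport
      (μ := (volume.restrict (Set.Ioc (-(π / 2)) (π / 2))).prod (volume : Measure ℝ)) hFs
    exact hI.integral_prod_right
  · refine Filter.Eventually.of_forall fun y => ?_
    have hcy : Continuous (fun x : ℝ => (x, y)) := by fun_prop
    have hslice : tsupport (fun x => V₃ (x, y)) ⊆ Set.Ioo (-(π / 2)) (π / 2) := by
      intro x hx
      exact (hsupp₃ (tsupport_comp_subset_preimage V₃ hcy hx)).1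
    have h1 := gr_oned (fun x => V₃ (x, y))
      ((hV₃.of_le (by exact_mod_cast le_top)).comp (contDiff_id.prodMk contDiff_const)) hslice
    simp only [gr_derivx V₃ hV₃] at h1
    refine h1.trans ?_
    refine intervalIntegral.integral_mono_on hle ?_ ?_ ?_
    · exact (((gr_fderiv_cont V₃ hV₃ _).pow 2).comp hcy).intervalIntegrable _ _
    · exact (hFc.comp hcy).intervalIntegrable _ _
    · intro x _
      have : 0 ≤ (fderiv ℝ V₄ (x, y) (1, 0)) ^ 2 + (1 / Real.cos x ^ 2) *
        ((fderiv ℝ V₃ (x, y) (0, 1)) ^ 2 + (fderiv ℝ V₄ (x, y) (0, 1)) ^ 2) := by positivity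
      linarith
end
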